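/- Let T be a universally elliptic 𝒜-tree. Then G admits a JSJ tree over 𝒜 if and only if for every vertex v of T, the stabilizer G_v admits a JSJ tree over 𝒜 relative to the incident edge stabilizers at v. -/

import Mathlib

universe u v

/-- A `G`-tree: a nonempty simple graph which is a tree (connected and acyclic),
with a minimal action of `G` by graph automorphisms without inversions. -/
structure GTree (G : Type u) [Group G] : Type (u + 1) where
  V : Type u
  graph : SimpleGraph V
  nonempty : Nonempty V
  connected : graph.Connected
  acyclic : graph.IsAcyclic
  act : G → V → V
  act_one : ∀ w, act 1 w = w
  act_mul : ∀ g h w, act (g * h) w = act g (act h w)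
  act_adj : ∀ g a b, graph.Adj a b → graph.Adj (act g a) (act g b)
  noInversion : ∀ g a b, graph.Adj a b → ¬(act g a = b ∧ act g b = a)
  minimal : ∀ S : Set V, S.Nonempty → (∀ g, ∀ w ∈ S, act g w ∈ S) →
    (graph.induce S).Connected → S = Set.univ

namespace GTree

variable {G : Type u} [Group G]

/-- The stabilizer of a vertex. -/
def vertexStab (T : GTree G) (w : T.V) : Subgroup G where
  carrier := {g | T.act g w = w}
  one_mem' := T.act_one w
  mul_mem' := by
    intro a b ha hb
    simp only [Set.mem_setOf_eq] at *
    rw [T.act_mul, hb, ha]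
  inv_mem' := by
    intro a ha
    simp only [Set.mem_setOf_eq] at *
    calc T.act a⁻¹ w = T.act a⁻¹ (T.act a w) := by rw [ha]
    _ = T.act (a⁻¹ * a) w := (T.act_mul _ _ _).symm
    _ = w := by rw [inv_mul_cancel, T.act_one]

/-- The stabilizer of an edge `{u,v}`: elements fixing both endpoints. -/
def edgeStab (T : GTree G) (a b : T.V) : Subgroup G :=
  T.vertexStab a ⊓ T.vertexStab b

/-- A subgroup is elliptic in `T` if it fixes a vertex. -/
def EllipticSubgroup (T : GTree G) (H : Subgroup G) : Prop :=
  ∃ w : T.V, ∀ h ∈ H, T.act h w = w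

/-- An element is elliptic in `T` if it fixes a vertex (otherwise it is hyperbolic). -/
def EllipticElt (T : GTree G) (g : G) : Prop :=
  ∃ w : T.V, T.act g w = w

/-- `T₁` dominates `T₂`: every subgroup elliptic in `T₁` is elliptic in `T₂`. -/
def Dominates (T₁ T₂ : GTree G) : Prop :=
  ∀ H : Subgroup G, T₁.EllipticSubgroup H → T₂.EllipticSubgroup H

/-- `T` is an `𝒜`-tree: all its edge stabilizers belong to `𝒜`. -/
def IsATree (T : GTree G) (𝒜 : Set (Subgroup G)) : Prop :=
  ∀ a b : T.V, T.graph.Adj a b → T.edgeStab a b ∈ 𝒜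

/-- A subgroup is universally elliptic if it is elliptic in every `𝒜`-tree. -/
def UnivEllipticSubgroup (𝒜 : Set (Subgroup G)) (H : Subgroup G) : Prop :=
  ∀ T : GTree G, T.IsATree 𝒜 → T.EllipticSubgroup H

/-- An `𝒜`-tree is universally elliptic if all its edge stabilizers are universally elliptic. -/
def UnivEllipticTree (T : GTree G) (𝒜 : Set (Subgroup G)) : Prop :=
  ∀ a b : T.V, T.graph.Adj a b → UnivEllipticSubgroup 𝒜 (T.edgeStab a b)

/-- A JSJ tree of `G` over `𝒜`: a universally elliptic `𝒜`-tree dominating every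
universally elliptic `𝒜`-tree. -/
def IsJSJ (T : GTree G) (𝒜 : Set (Subgroup G)) : Prop :=
  T.IsATree 𝒜 ∧ T.UnivEllipticTree 𝒜 ∧
    ∀ T' : GTree G, T'.IsATree 𝒜 → T'.UnivEllipticTree 𝒜 → T.Dominates T'

/-- A collapse map `T → T'`: a `G`-equivariant surjection on vertices sending adjacent
vertices to adjacent or equal vertices, with connected point preimages. -/
def IsCollapseMap (T T' : GTree G) (f : T.V → T'.V) : Prop :=
  (∀ g w, f (T.act g w) = T'.act g (f w)) ∧
    Function.Surjective f ∧
    (∀ a b : T.V, T.graph.Adj a b → f a = f b ∨ T'.graph.Adj (f a) (f b)) ∧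
    ∀ w : T'.V, (T.graph.induce (f ⁻¹' {w})).Connected

end GTree

/-- `𝒜` is closed under conjugation and under passing to subgroups. -/
def ClosedFamily {G : Type u} [Group G] (𝒜 : Set (Subgroup G)) : Prop :=
  (∀ H ∈ 𝒜, ∀ g : G, Subgroup.map (MulAut.conj g).toMonoidHom H ∈ 𝒜) ∧
    ∀ H ∈ 𝒜, ∀ K : Subgroup G, K ≤ H → K ∈ 𝒜

/-- `G` is finitely presented: it admits a presentation with finitely many generators
and finitely many relations. -/
def FinitelyPresentedGroup (G : Type u) [Group G] : Prop :=
  ∃ (n : ℕ) (rels : Set (FreeGroup (Fin n))),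
    rels.Finite ∧ Nonempty (PresentedGroup rels ≃* G)

/-- `T` is an `(𝒜,ℋ)`-tree: an `𝒜`-tree in which every subgroup in `ℋ` is elliptic. -/
def RelATree {G : Type u} [Group G] (𝒜 ℋ : Set (Subgroup G)) (T : GTree G) : Prop :=
  T.IsATree 𝒜 ∧ ∀ H ∈ ℋ, T.EllipticSubgroup H

/-- A subgroup is universally elliptic relative to `ℋ` if it is elliptic in every
`(𝒜,ℋ)`-tree. -/
def RelUnivEllipticSubgroup {G : Type u} [Group G] (𝒜 ℋ : Set (Subgroup G))
    (K : Subgroup G) : Prop :=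
  ∀ T : GTree G, RelATree 𝒜 ℋ T → T.EllipticSubgroup K

/-- An `(𝒜,ℋ)`-tree is universally elliptic if all its edge stabilizers are universally
elliptic relative to `ℋ`. -/
def RelUnivEllipticTree {G : Type u} [Group G] (𝒜 ℋ : Set (Subgroup G))
    (T : GTree G) : Prop :=
  ∀ a b : T.V, T.graph.Adj a b → RelUnivEllipticSubgroup 𝒜 ℋ (T.edgeStab a b)

/-- A JSJ tree of `G` over `𝒜` relative to `ℋ`. -/
def IsRelJSJ {G : Type u} [Group G] (𝒜 ℋ : Set (Subgroup G)) (T : GTree G) : Prop :=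
  RelATree 𝒜 ℋ T ∧ RelUnivEllipticTree 𝒜 ℋ T ∧
    ∀ T' : GTree G, RelATree 𝒜 ℋ T' → RelUnivEllipticTree 𝒜 ℋ T' → T.Dominates T'

/-- The family of groups `F, H₁, …, H_p` whose free product is used to define relative
finite presentability. -/
def relFam {G : Type u} [Group G] {p : ℕ} (H : Fin p → Subgroup G) (n : ℕ) :
    Option (Fin p) → Type u
  | none => FreeGroup (ULift.{u} (Fin n))
  | some j => H j

instance relFamGroup {G : Type u} [Group G] {p : ℕ} (H : Fin p → Subgroup G) (n : ℕ) :
    (i : Option (Fin p)) → Group (relFam H n i)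
  | none => inferInstanceAs (Group (FreeGroup _))
  | some j => inferInstanceAs (Group (H j))

/-- `G` is finitely presented relative to `H₁, …, H_p`: there is a surjection from
`F ∗ H₁ ∗ ⋯ ∗ H_p` (with `F` a finitely generated free group) onto `G` restricting to
the inclusion on each `Hᵢ`, whose kernel is the normal closure of a finite subset. -/
def RelFinitelyPresented {G : Type u} [Group G] {p : ℕ} (H : Fin p → Subgroup G) : Prop :=
  ∃ (n : ℕ) (φ : Monoid.CoprodI (relFam H n) →* G),
    Function.Surjective φ ∧
    (∀ (j : Fin p) (h : H j), φ (Monoid.CoprodI.of (M := relFam H n) (i := some j) h) = (h : G)) ∧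
    ∃ s : Set (Monoid.CoprodI (relFam H n)), s.Finite ∧
      MonoidHom.ker φ = Subgroup.normalClosure s

/-- `S` has a single orbit of edges. -/
def OneEdgeOrbit {G : Type u} [Group G] (S : GTree G) : Prop :=
  ∀ e₁ ∈ S.graph.edgeSet, ∀ e₂ ∈ S.graph.edgeSet, ∃ g : G, Sym2.map (S.act g) e₁ = e₂

/-- `G` splits over `K`: there is a nontrivial `G`-tree with a single orbit of edges
having `K` as an edge stabilizer. -/
def SplitsOver {G : Type u} [Group G] (K : Subgroup G) : Prop :=
  ∃ S : GTree G, Nontrivial S.V ∧ OneEdgeOrbit S ∧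
    ∃ x y : S.V, S.graph.Adj x y ∧ S.edgeStab x y = K

/-- A subgroup is slender if all its subgroups are finitely generated. -/
def SlenderSubgroup {G : Type u} [Group G] (H : Subgroup G) : Prop :=
  ∀ K : Subgroup G, K ≤ H → K.FG

/-- A subgroup is abelian. -/
def AbelianSubgroup {G : Type u} [Group G] (H : Subgroup G) : Prop :=
  ∀ a ∈ H, ∀ b ∈ H, a * b = b * a

/-- `H` is malnormal in `G`: `gHg⁻¹ ∩ H ≠ {1}` implies `g ∈ H`. -/
def Malnormal {G : Type u} [Group G] (H : Subgroup G) : Prop :=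
  ∀ g : G, (∃ x ∈ H, x ≠ 1 ∧ g * x * g⁻¹ ∈ H) → g ∈ H

/-- `G` is CSA: the centralizer of every nontrivial element is abelian and malnormal. -/
def IsCSA (G : Type u) [Group G] : Prop :=
  ∀ g : G, g ≠ 1 →
    AbelianSubgroup (Subgroup.centralizer {g}) ∧ Malnormal (Subgroup.centralizer {g})

namespace SimpleGraph

/-- `a` and `b` are joined by a walk of `Γ` staying in `S`. -/
def LinkedIn {X : Type*} (Γ : SimpleGraph X) (S : Set X) (a b : X) : Prop :=
  ∃ p : Γ.Walk a b, ∀ x ∈ p.support, x ∈ S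

namespace LinkedIn

variable {X Y : Type*} {Γ : SimpleGraph X} {Δ : SimpleGraph Y} {S S' : Set X} {a b c : X}

lemma refl (ha : a ∈ S) : Γ.LinkedIn S a a :=
  ⟨Walk.nil, by simpa using ha⟩

lemma symm (h : Γ.LinkedIn S a b) : Γ.LinkedIn S b a := by
  obtain ⟨p, hp⟩ := h
  exact ⟨p.reverse, by simpa using hp⟩

lemma trans (h : Γ.LinkedIn S a b) (h' : Γ.LinkedIn S b c) : Γ.LinkedIn S a c := by
  obtain ⟨p, hp⟩ := h
  obtain ⟨q, hq⟩ := h'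
  refine ⟨p.append q, fun x hx => ?_⟩
  rcases (Walk.mem_support_append_iff _ _).1 hx with h | h
  exacts [hp x h, hq x h]

lemma map (f : Γ →g Δ) {U : Set Y} (hf : ∀ x ∈ S, f x ∈ U) (h : Γ.LinkedIn S a b) :
    Δ.LinkedIn U (f a) (f b) := by
  obtain ⟨p, hp⟩ := h
  refine ⟨p.map f, fun y hy => ?_⟩
  rw [Walk.support_map, List.mem_map] at hy
  obtain ⟨x, hx, rfl⟩ := hy
  exact hf x (hp x hx)

/-- Maps of graphs which may collapse edges preserve linkedness. -/
lemma map_weak (f : X → Y) {U : Set Y} (hf : ∀ x ∈ S, f x ∈ U)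
    (hadj : ∀ x ∈ S, ∀ y ∈ S, Γ.Adj x y → f x = f y ∨ Δ.Adj (f x) (f y)) (h : Γ.LinkedIn S a b) :
    Δ.LinkedIn U (f a) (f b) := by
  obtain ⟨p, hp⟩ := h
  induction p with
  | nil => exact refl (hf _ (hp _ (by simp)))
  | @cons u v w huv p ih =>
    have hu : f u ∈ U := hf _ (hp _ (by simp))
    have hv : f v ∈ U := hf _ (hp _ (by simp))
    have ih := ih fun x hx => hp x (by simp [hx])
    rcases hadj _ (hp _ (by simp)) _ (hp _ (by simp)) huv with h | h
    · rwa [h]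
    · refine trans ⟨h.toWalk, fun x hx => ?_⟩ ih
      simp only [Walk.support_cons, Walk.support_nil, List.mem_cons, List.not_mem_nil,
        or_false] at hx
      rcases hx with rfl | rfl <;> assumption

lemma inter (hΓ : Γ.IsAcyclic) (h : Γ.LinkedIn S a b) (h' : Γ.LinkedIn S' a b) :
    Γ.LinkedIn (S ∩ S') a b := by
  classical
  obtain ⟨p, hp⟩ := h
  obtain ⟨q, hq⟩ := h'
  have hpq : p.bypass = q.bypass := congrArg Subtype.val
    ((hΓ.subsingleton_path _ _).elim ⟨p.bypass, p.bypass_isPath⟩ ⟨q.bypass, q.bypass_isPath⟩)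
  refine ⟨p.bypass, fun x hx => ⟨hp x (p.support_bypass_subset_support hx), ?_⟩⟩
  rw [hpq] at hx
  exact hq x (q.support_bypass_subset_support hx)

end LinkedIn

variable {X : Type*} {Γ : SimpleGraph X} {S : Set X}

lemma Preconnected.linkedIn (h : (Γ.induce S).Preconnected) {a b : X} (ha : a ∈ S) (hb : b ∈ S) :
    Γ.LinkedIn S a b := by
  obtain ⟨p⟩ := h ⟨a, ha⟩ ⟨b, hb⟩
  exact LinkedIn.map (S := Set.univ) (Embedding.induce S).toHom (fun x _ => x.2) ⟨p, by simp⟩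

lemma induce_preconnected_of_linkedIn (h : ∀ a ∈ S, ∀ b ∈ S, Γ.LinkedIn S a b) :
    (Γ.induce S).Preconnected := by
  rintro ⟨a, ha⟩ ⟨b, hb⟩
  obtain ⟨p, hp⟩ := h a ha b hb
  exact ⟨p.induce S hp⟩

lemma Preconnected.linkedIn_univ (h : Γ.Preconnected) (a b : X) : Γ.LinkedIn Set.univ a b := by
  obtain ⟨p⟩ := h a b
  exact ⟨p, by simp⟩

/-- A nearest point of a connected vertex set in an acyclic graph is unique. -/
lemma IsAcyclic.nearest_unique (hΓ : Γ.IsAcyclic) {M : Set X}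
    (hM : ∀ a ∈ M, ∀ b ∈ M, Γ.LinkedIn M a b) {x m m' : X} (hm : m ∈ M) (hm' : m' ∈ M) {n : ℕ}
    (hn : ∀ z ∈ M, ∀ p : Γ.Walk x z, n ≤ p.length)
    (p : Γ.Walk x m) (hp : p.length = n) (p' : Γ.Walk x m') (hp' : p'.length = n) : m = m' := by
  classical
  have key : ∀ {z : X}, z ∈ M → ∀ p : Γ.Walk x z, p.length = n → p.bypass.length = n :=
    fun hz p hp => le_antisymm (hp ▸ p.length_bypass_le_length) (hn _ hz _)
  obtain ⟨q, hq⟩ := hM m hm m' hm'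
  have hqs : ∀ z ∈ q.bypass.support, z ∈ M := fun z hz => hq z (q.support_bypass_subset_support hz)
  have hlast : ∀ z ∈ p.bypass.support, z ∈ M → z = m := by
    intro z hz hzM
    by_contra hne
    have h1 := Walk.length_takeUntil_lt_length hz hne
    have h2 := hn z hzM (p.bypass.takeUntil z hz)
    have h3 := key hm p hp
    omega
  have hpath : (p.bypass.append q.bypass).IsPath := by
    rw [Walk.isPath_def, Walk.support_append, List.nodup_append]
    refine ⟨p.bypass_isPath.support_nodup, q.bypass_isPath.support_nodup.tail, ?_⟩
    rintro z hz z' hz' rfl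
    have hzm := hlast z hz (hqs z (List.mem_of_mem_tail hz'))
    have hnd := q.bypass_isPath.support_nodup
    rw [← Walk.cons_tail_support, List.nodup_cons] at hnd
    exact hnd.1 (hzm ▸ hz')
  have heq : p.bypass.append q.bypass = p'.bypass := congrArg Subtype.val
    ((hΓ.subsingleton_path _ _).elim ⟨_, hpath⟩ ⟨_, p'.bypass_isPath⟩)
  have hlen := congrArg Walk.length heq
  rw [Walk.length_append, key hm p hp, key hm' p' hp'] at hlen
  exact Walk.eq_of_length_eq_zero (p := q.bypass) (by omega)

/-- An edge is a bridge if it is the only edge over an edge of some acyclic graph. -/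
lemma isBridge_of_map {Y : Type*} {Δ : SimpleGraph Y} (hΔ : Δ.IsAcyclic) (f : X → Y) {a b : X}
    (hab : Δ.Adj (f a) (f b))
    (hf : ∀ c d, Γ.Adj c d → s(c, d) ≠ s(a, b) →
      f c = f d ∨ (Δ.Adj (f c) (f d) ∧ s(f c, f d) ≠ s(f a, f b))) :
    Γ.IsBridge s(a, b) := by
  have hbr := isAcyclic_iff_forall_adj_isBridge.1 hΔ hab
  rw [isBridge_iff] at hbr ⊢
  contrapose! hbr
  obtain ⟨p, -⟩ := LinkedIn.map_weak (U := Set.univ) (Δ := Δ.deleteEdges {s(f a, f b)}) f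
    (by simp) (fun c _ d _ hcd => by
      rw [deleteEdges_adj] at hcd ⊢
      exact hf c d hcd.1 hcd.2) ⟨hbr.some, fun x _ => Set.mem_univ x⟩
  exact ⟨p⟩

end SimpleGraph

instance GTree.instMulAction {G : Type u} [Group G] (T : GTree G) : MulAction G T.V where
  smul := T.act
  one_smul := T.act_one
  mul_smul := T.act_mul

/-- A tree with an action of `G` without inversions, not necessarily minimal. -/
structure TreeAction (G : Type u) [Group G] : Type (u + 1) where
  V : Type u
  graph : SimpleGraph V
  connected : graph.Connected
  acyclic : graph.IsAcyclic
  action : MulAction G V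
  adj_smul : ∀ (g : G) a b, graph.Adj a b → graph.Adj (g • a) (g • b)
  noInversion : ∀ (g : G) a b, graph.Adj a b → ¬(g • a = b ∧ g • b = a)

attribute [instance] TreeAction.action

/-- The underlying tree action of a `G`-tree. -/
abbrev GTree.toTreeAction {G : Type u} [Group G] (T : GTree G) : TreeAction G where
  V := T.V
  graph := T.graph
  connected := T.connected
  acyclic := T.acyclic
  action := T.instMulAction
  adj_smul := T.act_adj
  noInversion := T.noInversion

namespace TreeAction

variable {G : Type u} [Group G] (X : TreeAction G)

/-- A vertex set is `G`-invariant, nonempty and spans a connected subgraph. -/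
structure IsSubtree (M : Set X.V) : Prop where
  nonempty : M.Nonempty
  smul_mem : ∀ (g : G), ∀ m ∈ M, g • m ∈ M
  linked : ∀ a ∈ M, ∀ b ∈ M, X.graph.LinkedIn M a b

variable {X}

lemma linkedIn_smul {M : Set X.V} (hM : ∀ (g : G), ∀ m ∈ M, g • m ∈ M) (g : G) {a b : X.V}
    (h : X.graph.LinkedIn M a b) : X.graph.LinkedIn M (g • a) (g • b) :=
  h.map ⟨fun x => g • x, fun {a b} hab => X.adj_smul g a b hab⟩ (hM g)

/-- A subgroup fixing a vertex and preserving a subtree fixes a vertex of this subtree. -/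
lemma exists_fixed_mem {M : Set X.V} (hne : M.Nonempty)
    (hlink : ∀ a ∈ M, ∀ b ∈ M, X.graph.LinkedIn M a b) (K : Subgroup G)
    (hK : ∀ k ∈ K, ∀ m ∈ M, k • m ∈ M) {x : X.V} (hx : ∀ k ∈ K, k • x = x) :
    ∃ m ∈ M, ∀ k ∈ K, k • m = m := by
  classical
  have hex : ∃ n : ℕ, ∃ m ∈ M, ∃ p : X.graph.Walk x m, p.length = n := by
    obtain ⟨m, hm⟩ := hne
    obtain ⟨p⟩ := X.connected.preconnected x m
    exact ⟨_, m, hm, p, rfl⟩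
  obtain ⟨m, hm, p, hp⟩ := Nat.find_spec hex
  have hmin : ∀ z ∈ M, ∀ q : X.graph.Walk x z, Nat.find hex ≤ q.length :=
    fun z hz q => Nat.find_min' hex ⟨z, hz, q, rfl⟩
  refine ⟨m, hm, fun k hk => ?_⟩
  let f : X.graph →g X.graph := ⟨fun y => k • y, fun {a b} hab => X.adj_smul k a b hab⟩
  have hfx : f x = x := hx k hk
  exact X.acyclic.nearest_unique hlink (hK k hk m hm) hm hmin
    ((p.map f).copy hfx rfl) (by simpa using hp) p hp

/-- A finitely generated group acting on a tree has a cocompact invariant subtree. -/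
lemma exists_cofinite_isSubtree (hG : Group.FG G) (X : TreeAction G) :
    ∃ (M F : Set X.V), X.IsSubtree M ∧ F.Finite ∧ ∀ m ∈ M, ∃ g : G, ∃ f ∈ F, m = g • f := by
  classical
  obtain ⟨s, hs, hfin⟩ := Group.fg_iff.1 hG
  obtain ⟨x₀⟩ := X.connected.nonempty
  have hwalk : ∀ a : G, Nonempty (X.graph.Walk x₀ (a • x₀)) :=
    fun a => X.connected.preconnected _ _
  let p : ∀ a : G, X.graph.Walk x₀ (a • x₀) := fun a => (hwalk a).some
  let F : Set X.V := {x₀} ∪ ⋃ a ∈ s, {x | x ∈ (p a).support}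
  let M : Set X.V := {m | ∃ g : G, ∃ f ∈ F, m = g • f}
  have hFM : F ⊆ M := fun f hf => ⟨1, f, hf, (one_smul _ _).symm⟩
  have hinv : ∀ (g : G), ∀ m ∈ M, g • m ∈ M := by
    rintro g _ ⟨h, f, hf, rfl⟩
    exact ⟨g * h, f, hf, (mul_smul _ _ _).symm⟩
  have hx₀ : x₀ ∈ M := hFM (Or.inl rfl)
  have hpF : ∀ a ∈ s, ∀ x ∈ (p a).support, x ∈ M := fun a ha x hx =>
    hFM (Or.inr (Set.mem_biUnion ha hx))
  have horb : ∀ g : G, X.graph.LinkedIn M x₀ (g • x₀) := by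
    intro g
    have hg : g ∈ Subgroup.closure s := by rw [hs]; trivial
    induction hg using Subgroup.closure_induction_left with
    | one => simpa using SimpleGraph.LinkedIn.refl hx₀
    | mul_left a ha y hy ih =>
      rw [mul_smul]
      exact SimpleGraph.LinkedIn.trans ⟨p a, hpF a ha⟩ (linkedIn_smul hinv a ih)
    | inv_mul_cancel a ha y hy ih =>
      rw [mul_smul]
      refine SimpleGraph.LinkedIn.trans ?_ (linkedIn_smul hinv a⁻¹ ih)
      have := linkedIn_smul hinv a⁻¹ (SimpleGraph.LinkedIn.symm ⟨p a, hpF a ha⟩)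
      rwa [inv_smul_smul] at this
  have hF : ∀ f ∈ F, X.graph.LinkedIn M x₀ f := by
    rintro f (rfl | hf)
    · exact SimpleGraph.LinkedIn.refl hx₀
    · obtain ⟨a, ha, hfa⟩ := Set.mem_iUnion₂.1 hf
      exact ⟨(p a).takeUntil f hfa, fun x hx =>
        hpF a ha x (SimpleGraph.Walk.support_takeUntil_subset_support _ hfa hx)⟩
  have hall : ∀ m ∈ M, X.graph.LinkedIn M x₀ m := by
    rintro _ ⟨g, f, hf, rfl⟩
    exact (horb g).trans (linkedIn_smul hinv g (hF f hf))
  refine ⟨M, F, ⟨⟨x₀, hx₀⟩, hinv, fun a ha b hb => (hall a ha).symm.trans (hall b hb)⟩, ?_,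
    fun m hm => hm⟩
  exact (Set.finite_singleton x₀).union
    (hfin.biUnion fun a _ => List.finite_toSet (p a).support)

/-- An invariant subtree, as a tree action. -/
abbrev IsSubtree.subMulAction {M : Set X.V} (hM : X.IsSubtree M) : MulAction G M where
  smul g m := ⟨g • m.1, hM.smul_mem g m.1 m.2⟩
  one_smul m := Subtype.ext (one_smul G m.1)
  mul_smul g h m := Subtype.ext (mul_smul g h m.1)

/-- A cocompact invariant subtree contains a minimal one. -/
lemma IsSubtree.exists_gtree {M F : Set X.V} (hM : X.IsSubtree M) (hF : F.Finite)
    (hMF : ∀ m ∈ M, ∃ g : G, ∃ f ∈ F, m = g • f) :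
    ∃ (R : GTree G) (i : R.V → X.V), Function.Injective i ∧
      (∀ (g : G) x, i (R.act g x) = g • i x) ∧
      (∀ x y, R.graph.Adj x y → X.graph.Adj (i x) (i y)) ∧ X.IsSubtree (Set.range i) := by
  classical
  have hex : ∃ n : ℕ, ∃ N ⊆ M, X.IsSubtree N ∧ (F ∩ N).ncard = n := ⟨_, M, subset_rfl, hM, rfl⟩
  obtain ⟨N, hNM, hN, hcard⟩ := Nat.find_spec hex
  have hmin : ∀ N' ⊆ N, X.IsSubtree N' → N' = N := by
    intro N' hN' hsub
    have h1 := Nat.find_min' hex ⟨N', hN'.trans hNM, hsub, rfl⟩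
    have h2 : F ∩ N' = F ∩ N := Set.eq_of_subset_of_ncard_le
      (Set.inter_subset_inter_right _ hN') (by omega) (hF.inter_of_left N)
    refine hN'.antisymm fun x hx => ?_
    obtain ⟨g, f, hf, rfl⟩ := hMF x (hNM hx)
    have hfN : f ∈ N := by simpa using hN.smul_mem g⁻¹ _ hx
    exact hsub.smul_mem g f (h2 ▸ ⟨hf, hfN⟩ : f ∈ F ∩ N').2
  have hne : Nonempty N := hN.nonempty.to_subtype
  let act : MulAction G N := hN.subMulAction
  refine ⟨{ V := N
            graph := X.graph.induce N
            nonempty := hne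
            connected := ⟨SimpleGraph.induce_preconnected_of_linkedIn hN.linked⟩
            acyclic := X.acyclic.induce N
            act := fun g x => g • x
            act_one := one_smul G
            act_mul := mul_smul
            act_adj := fun g a b h => X.adj_smul g a b h
            noInversion := fun g a b h h' => X.noInversion g a b h
              ⟨congrArg Subtype.val h'.1, congrArg Subtype.val h'.2⟩
            minimal := ?_ }, Subtype.val, Subtype.val_injective, fun _ _ => rfl,
            fun _ _ h => h, by rwa [Subtype.range_val]⟩
  intro S hS hinv hconn
  have hval : Subtype.val '' S = N := by
    refine hmin _ (Subtype.coe_image_subset N S) ⟨hS.image _, ?_, ?_⟩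
    · rintro g _ ⟨m, hm, rfl⟩
      exact ⟨g • m, hinv g m hm, rfl⟩
    · rintro _ ⟨a, ha, rfl⟩ _ ⟨b, hb, rfl⟩
      exact (hconn.preconnected.linkedIn ha hb).map (SimpleGraph.Embedding.induce N).toHom
        (fun x hx => ⟨x, hx, rfl⟩)
  refine Set.eq_univ_of_forall fun x => ?_
  obtain ⟨y, hy, hyx⟩ : (x : X.V) ∈ Subtype.val '' S := by rw [hval]; exact x.2
  exact Subtype.ext hyx ▸ hy

/-- The restriction of a tree action to a subgroup. -/
abbrev restrict (X : TreeAction G) (H : Subgroup G) : TreeAction H where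
  V := X.V
  graph := X.graph
  connected := X.connected
  acyclic := X.acyclic
  action := inferInstance
  adj_smul := fun g => X.adj_smul g
  noInversion := fun g => X.noInversion g

end TreeAction

lemma GTree.eq_univ_of_isSubtree {G : Type u} [Group G] (T : GTree G) {M : Set T.V}
    (hM : T.toTreeAction.IsSubtree M) : M = Set.univ := by
  have := hM.nonempty.to_subtype
  exact T.minimal M hM.nonempty hM.smul_mem
    ⟨SimpleGraph.induce_preconnected_of_linkedIn hM.linked⟩

/-- Orbit representatives containing a prescribed point, with transporting elements. -/
lemma MulAction.exists_representatives {G A : Type*} [Group G] [MulAction G A] (a₀ : A) :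
    ∃ (rep : A → A) (t : A → G), rep a₀ = a₀ ∧ (∀ a, t a • rep a = a) ∧
      (∀ (g : G) a, rep (g • a) = rep a) ∧ ∀ a, rep a = a → t a = 1 := by
  classical
  let rep : A → A := fun a => if a ∈ MulAction.orbit G a₀ then a₀ else
    (Quotient.mk (MulAction.orbitRel G A) a).out
  have hrep : ∀ a, ∃ g : G, g • rep a = a := by
    intro a
    by_cases h : a ∈ MulAction.orbit G a₀
    · obtain ⟨g, hg⟩ := h
      exact ⟨g, by simpa only [rep, if_pos (show a ∈ MulAction.orbit G a₀ from ⟨g, hg⟩)] using hg⟩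
    · simp only [rep, if_neg h]
      exact (MulAction.orbitRel G A).symm (Quotient.mk_out (s := MulAction.orbitRel G A) a)
  choose t ht using hrep
  refine ⟨rep, fun a => if rep a = a then 1 else t a, ?_, ?_, ?_, fun a h => if_pos h⟩
  · exact if_pos (MulAction.mem_orbit_self a₀)
  · intro a
    dsimp only
    split_ifs with h
    · rw [one_smul, h]
    · exact ht a
  · intro g a
    have h1 : g • a ∈ MulAction.orbit G a₀ ↔ a ∈ MulAction.orbit G a₀ :=
      ⟨fun h => by simpa using MulAction.mem_orbit_of_mem_orbit g⁻¹ h,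
        fun h => MulAction.mem_orbit_of_mem_orbit g h⟩
    have h2 : Quotient.mk (MulAction.orbitRel G A) (g • a) =
        Quotient.mk (MulAction.orbitRel G A) a := Quotient.sound ⟨g, rfl⟩
    simp only [rep, h1, h2]

/-- Equivariant choice: a `G`-invariant relation admits an equivariant choice function as soon as
each point is related to a point fixed by its stabilizer. -/
lemma MulAction.exists_equivariant_choice {G A X : Type*} [Group G] [MulAction G A]
    [MulAction G X] [Nonempty X] (P : A → Prop) (hP : ∀ (g : G) a, P (g • a) ↔ P a)
    (Q : A → X → Prop) (hQ : ∀ (g : G) a x, Q a x → Q (g • a) (g • x))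
    (h : ∀ a, P a → ∃ x, Q a x ∧ ∀ g : G, g • a = a → g • x = x) :
    ∃ p : A → X, ∀ a, P a → Q a (p a) ∧ ∀ g : G, p (g • a) = g • p a := by
  rcases isEmpty_or_nonempty A with _ | ⟨⟨a₀⟩⟩
  · exact ⟨isEmptyElim, isEmptyElim⟩
  obtain ⟨rep, t, -, ht, hrep, -⟩ := MulAction.exists_representatives (G := G) a₀
  have h' : ∀ a, ∃ x : X, P a → Q a x ∧ ∀ g : G, g • a = a → g • x = x := by
    intro a
    by_cases ha : P a
    · obtain ⟨x, hx⟩ := h a ha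
      exact ⟨x, fun _ => hx⟩
    · exact ⟨Classical.arbitrary X, fun h => absurd h ha⟩
  choose x hx using h'
  have hPr : ∀ a, P a → P (rep a) := fun a ha => by rwa [← hP (t a), ht]
  refine ⟨fun a => t a • x (rep a), fun a ha => ⟨?_, fun g => ?_⟩⟩
  · have := hQ (t a) _ _ (hx (rep a) (hPr a ha)).1
    rwa [ht] at this
  · have hfix : ((t (g • a))⁻¹ * (g * t a)) • rep a = rep a := by
      rw [mul_smul, mul_smul, ht, inv_smul_eq_iff]
      conv_rhs => rw [← hrep g a]
      exact (ht _).symm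
    have := (hx (rep a) (hPr a ha)).2 _ hfix
    rw [mul_smul, inv_smul_eq_iff, mul_smul] at this
    change t (g • a) • x (rep (g • a)) = g • t a • x (rep a)
    rw [hrep, this]

/-- A blow-up of `T`: a tree action mapping onto `T`, whose fibres over a set `R` of vertices
meeting each orbit and containing `v₀` are identified with prescribed trees. -/
structure Blowup {G : Type u} [Group G] (T : GTree G) (S : ∀ w, TreeAction (T.vertexStab w))
    (v₀ : T.V) where
  B : TreeAction G
  proj : B.V → T.V
  R : Set T.V
  incl : ∀ w ∈ R, (S w).V → B.V
  base_mem : v₀ ∈ R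
  exists_rep : ∀ u, ∃ g : G, ∃ w ∈ R, u = g • w
  proj_smul : ∀ (g : G) b, proj (g • b) = g • proj b
  proj_adj : ∀ a b, B.graph.Adj a b → proj a = proj b ∨ T.graph.Adj (proj a) (proj b)
  proj_incl : ∀ w hw x, proj (incl w hw x) = w
  exists_incl : ∀ w hw b, proj b = w → ∃ x, incl w hw x = b
  incl_injective : ∀ w hw, Function.Injective (incl w hw)
  incl_adj : ∀ w hw x y, B.graph.Adj (incl w hw x) (incl w hw y) ↔ (S w).graph.Adj x y
  incl_smul : ∀ w hw (h : T.vertexStab w) x, incl w hw (h • x) = (h : G) • incl w hw x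

namespace Blowup

variable {G : Type u} [Group G] {T : GTree G}

lemma cocycle_mem {rep : T.V → T.V} {t : T.V → G} (ht : ∀ a, t a • rep a = a)
    (hrep : ∀ (g : G) a, rep (g • a) = rep a) (g : G) {r w : T.V} (hw : rep w = r) :
    (t (g • w))⁻¹ * g * t w ∈ T.vertexStab r := by
  change ((t (g • w))⁻¹ * g * t w) • r = r
  subst hw
  rw [mul_smul, mul_smul, ht, inv_smul_eq_iff]
  conv_rhs => rw [← hrep g w]
  exact (ht _).symm

variable (S : ∀ w, TreeAction (T.vertexStab w)) (rep : T.V → T.V)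

/-- The vertex set of a blow-up: the disjoint union of copies of the trees `S r` over the
vertices represented by `r`. -/
abbrev Total : Type u := Σ r : T.V, {w : T.V // rep w = r} × (S r).V

variable {rep}

/-- The action of `G` on the vertex set of a blow-up. -/
abbrev totalAction {t : T.V → G} (ht : ∀ a, t a • rep a = a)
    (hrep : ∀ (g : G) a, rep (g • a) = rep a) : MulAction G (Total S rep) where
  smul g a := ⟨a.1, ⟨g • a.2.1.1, (hrep g _).trans a.2.1.2⟩,
    (⟨_, cocycle_mem ht hrep g a.2.1.2⟩ : T.vertexStab a.1) • a.2.2⟩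
  one_smul := by
    rintro ⟨r, ⟨w, hw⟩, x⟩
    refine congrArg (Sigma.mk r) (Prod.ext (Subtype.ext (one_smul G w)) ?_)
    change (⟨_, _⟩ : T.vertexStab r) • x = x
    convert one_smul (T.vertexStab r) x
    simp
  mul_smul := by
    rintro g h ⟨r, ⟨w, hw⟩, x⟩
    refine congrArg (Sigma.mk r) (Prod.ext (Subtype.ext (mul_smul g h w)) ?_)
    change (⟨_, _⟩ : T.vertexStab r) • x =
      (⟨_, _⟩ : T.vertexStab r) • (⟨_, _⟩ : T.vertexStab r) • x
    rw [← mul_smul]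
    congr 1
    apply Subtype.ext
    change (t ((g * h) • w))⁻¹ * (g * h) * t w =
      ((t (g • h • w))⁻¹ * g * t (h • w)) * ((t (h • w))⁻¹ * h * t w)
    rw [mul_smul]
    group

variable {S}

/-- The projection of a blow-up to the base tree. -/
def base (a : Total S rep) : T.V := a.2.1.1

variable (S rep) in
/-- The disjoint union of the fibres of a blow-up. -/
def fibreGraph : SimpleGraph (Total S rep) where
  Adj a b := ∃ r w x y, (S r).graph.Adj x y ∧ a = ⟨r, w, x⟩ ∧ b = ⟨r, w, y⟩
  symm.symm := by
    rintro _ _ ⟨r, w, x, y, h, rfl, rfl⟩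
    exact ⟨r, w, y, x, h.symm, rfl, rfl⟩
  loopless.irrefl := by
    rintro a ⟨r, w, x, y, h, rfl, h'⟩
    simp only [Sigma.mk.injEq, heq_eq_eq, Prod.mk.injEq, true_and] at h'
    exact h.ne h'

lemma fibreGraph_adj {r : T.V} {w : {w : T.V // rep w = r}} {x y : (S r).V} :
    (fibreGraph S rep).Adj ⟨r, w, x⟩ ⟨r, w, y⟩ ↔ (S r).graph.Adj x y := by
  refine ⟨?_, fun h => ⟨r, w, x, y, h, rfl, rfl⟩⟩
  rintro ⟨r', w', x', y', h, h1, h2⟩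
  obtain rfl : r = r' := congrArg Sigma.fst h1
  simp only [Sigma.mk.injEq, heq_eq_eq, Prod.mk.injEq, true_and] at h1 h2
  rwa [h1.2, h2.2]

lemma base_eq_of_fibreGraph_adj {a b : Total S rep} (h : (fibreGraph S rep).Adj a b) :
    base a = base b := by
  obtain ⟨r, w, x, y, -, rfl, rfl⟩ := h
  rfl

lemma fibreGraph_isAcyclic : (fibreGraph S rep).IsAcyclic := by
  classical
  rw [SimpleGraph.isAcyclic_iff_forall_adj_isBridge]
  rintro _ _ ⟨r, w, x, y, h, rfl, rfl⟩
  let f : Total S rep → (S r).V := fun c =>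
    if hc : c.1 = r then if c.2.1.1 = w.1 then hc ▸ c.2.2 else x else x
  have hf : ∀ z, f ⟨r, w, z⟩ = z := fun z => by simp [f]
  refine SimpleGraph.isBridge_of_map (S r).acyclic f (by rwa [hf, hf]) ?_
  rintro _ _ ⟨r', w', x', y', h', rfl, rfl⟩ hne
  by_cases hr : r' = r
  · subst hr
    by_cases hw : w' = w
    · subst hw
      right
      simp only [hf]
      refine ⟨h', fun heq => hne ?_⟩
      simpa using congrArg (Sym2.map fun z => (⟨r', w', z⟩ : Total S rep)) heq
    · have hw' : w'.1 ≠ w.1 := fun h => hw (Subtype.ext h)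
      left
      simp [f, hw']
  · left
    simp [f, hr]

lemma fibreGraph_reachable {a b : Total S rep} (h : base a = base b) :
    (fibreGraph S rep).Reachable a b := by
  obtain ⟨r, ⟨w, hw⟩, x⟩ := a
  obtain ⟨r', ⟨w', hw'⟩, y⟩ := b
  change w = w' at h
  subst hw hw'
  subst h
  obtain ⟨p⟩ := (S (rep w)).connected.preconnected x y
  let f : (S (rep w)).graph →g fibreGraph S rep :=
    ⟨fun z => ⟨rep w, ⟨w, rfl⟩, z⟩, fun h => fibreGraph_adj.2 h⟩
  exact ⟨p.map f⟩

/-- The graph of a blow-up, with the edges of `T` attached at the points given by `p`. -/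
def totalGraph (p : T.V × T.V → Total S rep) : SimpleGraph (Total S rep) where
  Adj a b := (fibreGraph S rep).Adj a b ∨
    (T.graph.Adj (base a) (base b) ∧ a = p (base a, base b) ∧ b = p (base b, base a))
  symm.symm := by
    rintro a b (h | ⟨h, ha, hb⟩)
    exacts [Or.inl h.symm, Or.inr ⟨h.symm, hb, ha⟩]
  loopless.irrefl := by
    rintro a (h | ⟨h, -⟩)
    exacts [h.ne rfl, h.ne rfl]

lemma totalGraph_isAcyclic (p : T.V × T.V → Total S rep) : (totalGraph p).IsAcyclic := by
  have hbr : ∀ a b, T.graph.Adj (base a) (base b) → a = p (base a, base b) →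
      b = p (base b, base a) → (totalGraph p).IsBridge s(a, b) := by
    intro a b h ha hb
    refine SimpleGraph.isBridge_of_map T.acyclic base h ?_
    rintro c d (hcd | ⟨hcd, hc, hd⟩) hne
    · exact Or.inl (base_eq_of_fibreGraph_adj hcd)
    · refine Or.inr ⟨hcd, fun heq => hne ?_⟩
      rcases Sym2.eq_iff.1 heq with ⟨h1, h2⟩ | ⟨h1, h2⟩
      · have hca : c = a := by rw [hc, h1, h2, ← ha]
        have hdb : d = b := by rw [hd, h1, h2, ← hb]
        rw [hca, hdb]
      · have hcb : c = b := by rw [hc, h1, h2, ← hb]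
        have hda : d = a := by rw [hd, h1, h2, ← ha]
        rw [hcb, hda, Sym2.eq_swap]
  intro a c hc
  have hedge : ∀ e ∈ c.edges, e ∈ (fibreGraph S rep).edgeSet := by
    intro e he
    induction e using Sym2.ind with
    | _ x y =>
      rcases c.adj_of_mem_edges he with h | ⟨h, hx, hy⟩
      · exact h
      · exact absurd he ((SimpleGraph.isBridge_iff_forall_cycle_notMem
          (c.adj_of_mem_edges he)).1 (hbr x y h hx hy) c hc)
  exact fibreGraph_isAcyclic _ (hc.transfer hedge)

lemma totalGraph_connected (p : T.V × T.V → Total S rep)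
    (hp : ∀ u w, T.graph.Adj u w → base (p (u, w)) = u) : (totalGraph p).Connected := by
  have hle : fibreGraph S rep ≤ totalGraph p := fun a b h => Or.inl h
  have hfib : ∀ a b : Total S rep, base a = base b → (totalGraph p).Reachable a b :=
    fun a b h => (fibreGraph_reachable h).mono hle
  have hwalk : ∀ {u w : T.V}, T.graph.Walk u w → ∀ a b : Total S rep, base a = u → base b = w →
      (totalGraph p).Reachable a b := by
    intro u w q
    induction q with
    | nil => exact fun a b ha hb => hfib a b (ha.trans hb.symm)
    | @cons u v w huv q ih =>
      intro a b ha hb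
      have h1 := hp u v huv
      have h2 := hp v u huv.symm
      have hadj : (totalGraph p).Adj (p (u, v)) (p (v, u)) :=
        Or.inr (by rw [h1, h2]; exact ⟨huv, rfl, rfl⟩)
      exact (hfib a _ (ha.trans h1.symm)).trans (hadj.reachable.trans (ih _ b h2 hb))
  obtain ⟨v⟩ := T.nonempty
  obtain ⟨x⟩ := (S (rep v)).connected.nonempty
  have : Nonempty (Total S rep) := ⟨⟨rep v, ⟨v, rfl⟩, x⟩⟩
  refine ⟨fun a b => ?_⟩
  obtain ⟨q⟩ := T.connected.preconnected (base a) (base b)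
  exact hwalk q a b rfl rfl

variable (S) in
/-- Blow-ups exist when incident edge stabilizers are elliptic in the prescribed trees. -/
theorem nonempty (hS : ∀ w u, T.graph.Adj w u → ∃ x : (S w).V,
      ∀ h : T.vertexStab w, (h : G) ∈ T.vertexStab u → h • x = x) (v₀ : T.V) :
    Nonempty (Blowup T S v₀) := by
  obtain ⟨rep, t, hv₀, ht, hrep, ht1⟩ := MulAction.exists_representatives (G := G) v₀
  have hreprep : ∀ w, rep (rep w) = rep w := fun w => by
    conv_rhs => rw [← ht w, hrep]
  let act : MulAction G (Total S rep) := totalAction S ht hrep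
  have hbase : ∀ (g : G) (a : Total S rep), base (g • a) = g • base a := fun _ _ => rfl
  let i : ∀ w, rep w = w → (S w).V → Total S rep := fun w hw x => ⟨w, ⟨w, hw⟩, x⟩
  have hi : ∀ w hw (h : T.vertexStab w) x, i w hw (h • x) = (h : G) • i w hw x := by
    intro w hw h x
    refine congrArg (Sigma.mk w) (Prod.ext (Subtype.ext h.2.symm) ?_)
    change h • x = (⟨(t ((h : G) • w))⁻¹ * h * t w, _⟩ : T.vertexStab w) • x
    congr 1
    apply Subtype.ext
    change (h : G) = (t ((h : G) • w))⁻¹ * h * t w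
    rw [show (h : G) • w = w from h.2, ht1 w hw]
    simp
  obtain ⟨x₀⟩ := (S v₀).connected.nonempty
  have : Nonempty (Total S rep) := ⟨i v₀ hv₀ x₀⟩
  have hadj : ∀ (g : G) u w, T.graph.Adj (g • u) (g • w) ↔ T.graph.Adj u w := fun g u w =>
    ⟨fun h => by simpa using T.toTreeAction.adj_smul g⁻¹ _ _ h, T.toTreeAction.adj_smul g u w⟩
  obtain ⟨p, hp⟩ := MulAction.exists_equivariant_choice (G := G) (A := T.V × T.V)
    (X := Total S rep) (fun e => T.graph.Adj e.1 e.2) (fun g e => hadj g e.1 e.2)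
    (fun e x => base x = e.1)
    (fun g e x h => by rw [hbase, h]; rfl)
    (by
      rintro ⟨u, w⟩ huw
      have hr : T.graph.Adj (rep u) ((t u)⁻¹ • w) := by
        rw [← hadj (t u), ht, smul_inv_smul]
        exact huw
      obtain ⟨x, hx⟩ := hS _ _ hr
      refine ⟨t u • i (rep u) (hreprep u) x, ht u, fun g hg => ?_⟩
      obtain ⟨hgu, hgw⟩ : g • u = u ∧ g • w = w := by simpa using hg
      have hmem : (t u)⁻¹ * g * t u ∈ T.vertexStab (rep u) := by
        change ((t u)⁻¹ * g * t u) • rep u = rep u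
        rw [mul_smul, mul_smul, ht, hgu, inv_smul_eq_iff, ht]
      have hfix := hx ⟨_, hmem⟩ (by
        change ((t u)⁻¹ * g * t u) • (t u)⁻¹ • w = (t u)⁻¹ • w
        rw [mul_smul, smul_inv_smul, mul_smul, hgw])
      have h2 := hi _ (hreprep u) ⟨_, hmem⟩ x
      rw [hfix] at h2
      change _ = ((t u)⁻¹ * g * t u) • _ at h2
      rw [mul_smul, mul_smul, ← smul_eq_iff_eq_inv_smul] at h2
      exact h2.symm)
  have hsmul : ∀ (g : G) (a b : Total S rep), (totalGraph p).Adj a b →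
      (totalGraph p).Adj (g • a) (g • b) := by
    rintro g a b (h | ⟨h, ha, hb⟩)
    · obtain ⟨r, w, x, y, h, rfl, rfl⟩ := h
      exact Or.inl ⟨r, _, _, _, (S r).adj_smul _ _ _ h, rfl, rfl⟩
    · right
      rw [hbase, hbase]
      refine ⟨(hadj g _ _).2 h, ?_, ?_⟩
      · exact (congrArg (g • ·) ha).trans ((hp (base a, base b) h).2 g).symm
      · exact (congrArg (g • ·) hb).trans ((hp (base b, base a) h.symm).2 g).symm
  refine ⟨{
    B := {
      V := Total S rep
      graph := totalGraph p
      connected := totalGraph_connected p fun u w h => (hp (u, w) h).1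
      acyclic := totalGraph_isAcyclic p
      action := act
      adj_smul := hsmul
      noInversion := ?_ }
    proj := base
    R := {w | rep w = w}
    incl := i
    base_mem := hv₀
    exists_rep := fun u => ⟨t u, rep u, hreprep u, (ht u).symm⟩
    proj_smul := hbase
    proj_adj := ?_
    proj_incl := fun _ _ _ => rfl
    exists_incl := ?_
    incl_injective := ?_
    incl_adj := ?_
    incl_smul := hi }⟩
  · rintro g a b (h | ⟨h, -, -⟩) ⟨h1, h2⟩
    · obtain ⟨r, ⟨w, hw⟩, x, y, h, rfl, rfl⟩ := h
      have e1 := congrArg Prod.snd (eq_of_heq (Sigma.ext_iff.1 h1).2)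
      have e2 := congrArg Prod.snd (eq_of_heq (Sigma.ext_iff.1 h2).2)
      exact (S r).noInversion _ _ _ h ⟨e1, e2⟩
    · exact T.toTreeAction.noInversion g _ _ h
        ⟨by rw [← hbase, h1], by rw [← hbase, h2]⟩
  · rintro a b (h | ⟨h, -, -⟩)
    exacts [Or.inl (base_eq_of_fibreGraph_adj h), Or.inr h]
  · rintro w hw ⟨r, ⟨w', hw'⟩, x⟩ hb
    change w' = w at hb
    subst hb
    obtain rfl : r = w' := hw'.symm.trans hw
    exact ⟨x, rfl⟩
  · intro w hw x y h
    simpa [i] using h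
  · intro w hw x y
    refine ⟨?_, fun h => Or.inl (fibreGraph_adj.2 h)⟩
    rintro (h | ⟨h, -, -⟩)
    exacts [fibreGraph_adj.1 h, absurd rfl h.ne]

variable {S : ∀ w, TreeAction (T.vertexStab w)} {v₀ : T.V} (D : Blowup T S v₀)

lemma fibre_linked {w : T.V} (hw : w ∈ D.R) {a b : D.B.V} (ha : D.proj a = w)
    (hb : D.proj b = w) : D.B.graph.LinkedIn {c | D.proj c = w} a b := by
  obtain ⟨x, rfl⟩ := D.exists_incl w hw a ha
  obtain ⟨y, rfl⟩ := D.exists_incl w hw b hb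
  exact ((S w).connected.preconnected.linkedIn_univ x y).map
    ⟨D.incl w hw, fun h => (D.incl_adj w hw _ _).2 h⟩ fun z _ => D.proj_incl w hw z

variable {D}

lemma exists_mem_proj_eq {M : Set D.B.V} (hM : D.B.IsSubtree M) (u : T.V) :
    ∃ m ∈ M, D.proj m = u := by
  have : D.proj '' M = Set.univ := by
    refine T.eq_univ_of_isSubtree ⟨hM.nonempty.image _, ?_, ?_⟩
    · rintro g _ ⟨m, hm, rfl⟩
      exact ⟨g • m, hM.smul_mem g m hm, D.proj_smul g m⟩
    · rintro _ ⟨a, ha, rfl⟩ _ ⟨b, hb, rfl⟩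
      exact (hM.linked a ha b hb).map_weak D.proj (fun x hx => ⟨x, hx, rfl⟩)
        fun x _ y _ h => D.proj_adj x y h
  exact (this.symm ▸ Set.mem_univ u : u ∈ D.proj '' M)

lemma isSubtree_preimage_incl {M : Set D.B.V} (hM : D.B.IsSubtree M) {w : T.V} (hw : w ∈ D.R) :
    (S w).IsSubtree (D.incl w hw ⁻¹' M) := by
  obtain ⟨x₀⟩ := (S w).connected.nonempty
  refine ⟨?_, ?_, ?_⟩
  · obtain ⟨m, hm, hmw⟩ := exists_mem_proj_eq hM w
    obtain ⟨x, rfl⟩ := D.exists_incl w hw m hmw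
    exact ⟨x, hm⟩
  · intro g m hm
    rw [Set.mem_preimage, D.incl_smul]
    exact hM.smul_mem _ _ hm
  · intro a ha b hb
    have hab := (hM.linked _ ha _ hb).inter D.B.acyclic
      (D.fibre_linked hw (D.proj_incl w hw a) (D.proj_incl w hw b))
    have : Nonempty (S w).V := ⟨x₀⟩
    let r : D.B.V → (S w).V := Function.invFun (D.incl w hw)
    have hr : ∀ x, r (D.incl w hw x) = x := Function.leftInverse_invFun (D.incl_injective w hw)
    have hr' : ∀ c, D.proj c = w → D.incl w hw (r c) = c := fun c hc => by
      obtain ⟨x, rfl⟩ := D.exists_incl w hw c hc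
      rw [hr]
    have := hab.map_weak (Δ := (S w).graph) (U := D.incl w hw ⁻¹' M) r
      (fun c hc => by rw [Set.mem_preimage, hr' c hc.2]; exact hc.1)
      (fun c hc d hd h => Or.inr (by rwa [← D.incl_adj w hw, hr' c hc.2, hr' d hd.2]))
    rwa [hr, hr] at this

lemma eq_univ_of_isSubtree (hS : ∀ w, ∀ M : Set (S w).V, (S w).IsSubtree M → M = Set.univ)
    {M : Set D.B.V} (hM : D.B.IsSubtree M) : M = Set.univ := by
  refine Set.eq_univ_of_forall fun b => ?_
  obtain ⟨g, w, hw, hg⟩ := D.exists_rep (D.proj b)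
  obtain ⟨x, hx⟩ := D.exists_incl w hw (g⁻¹ • b) (by rw [D.proj_smul, hg, inv_smul_smul])
  have hmem : x ∈ D.incl w hw ⁻¹' M := by
    rw [hS w _ (isSubtree_preimage_incl hM hw)]
    trivial
  rw [Set.mem_preimage, hx] at hmem
  simpa using hM.smul_mem g _ hmem

variable (D) in
/-- A blow-up with minimal fibres is minimal. -/
abbrev toGTree (hS : ∀ w, ∀ M : Set (S w).V, (S w).IsSubtree M → M = Set.univ) : GTree G where
  V := D.B.V
  graph := D.B.graph
  nonempty := D.B.connected.nonempty
  connected := D.B.connected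
  acyclic := D.B.acyclic
  act := fun g x => g • x
  act_one := one_smul G
  act_mul := mul_smul
  act_adj := D.B.adj_smul
  noInversion := D.B.noInversion
  minimal := fun _ hne hinv hconn => eq_univ_of_isSubtree hS
    ⟨hne, hinv, fun _ ha _ hb => hconn.preconnected.linkedIn ha hb⟩

end Blowup

section Vertex

variable {G : Type u} [Group G]

lemma GTree.EllipticSubgroup.mono {T : GTree G} {H K : Subgroup G} (hH : T.EllipticSubgroup H)
    (hK : K ≤ H) : T.EllipticSubgroup K := by
  obtain ⟨w, hw⟩ := hH
  exact ⟨w, fun k hk => hw k (hK hk)⟩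

lemma GTree.EllipticSubgroup.conj {T : GTree G} {H : Subgroup G} (hH : T.EllipticSubgroup H)
    (g : G) : T.EllipticSubgroup (H.map (MulAut.conj g).toMonoidHom) := by
  obtain ⟨w, hw⟩ := hH
  refine ⟨g • w, ?_⟩
  rintro _ ⟨h, hh, rfl⟩
  change (g * h * g⁻¹) • g • w = g • w
  rw [mul_smul, inv_smul_smul, mul_smul]
  exact congrArg (g • ·) (hw h hh)

/-- If the edge stabilizers of `T` are elliptic in `T'`, each vertex stabilizer of `T` has a
minimal subtree in `T'`. -/
theorem GTree.exists_restriction (hfg : Group.FG G) (T T' : GTree G)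
    (hell : ∀ a b, T.graph.Adj a b → T'.EllipticSubgroup (T.edgeStab a b)) (v : T.V) :
    ∃ R : GTree (T.vertexStab v),
      (∀ x y, R.graph.Adj x y → ∃ a b, T'.graph.Adj a b ∧
        (R.edgeStab x y).map (T.vertexStab v).subtype ≤ T'.edgeStab a b) ∧
      ∀ K : Subgroup (T.vertexStab v), R.EllipticSubgroup K ↔
        T'.EllipticSubgroup (K.map (T.vertexStab v).subtype) := by
  let S : ∀ w, TreeAction (T.vertexStab w) := fun w => T'.toTreeAction.restrict (T.vertexStab w)
  obtain ⟨D⟩ := Blowup.nonempty S (fun w u hwu => by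
    obtain ⟨x, hx⟩ := hell w u hwu
    exact ⟨x, fun h hh => hx h ⟨h.2, hh⟩⟩) v
  obtain ⟨M, F, hM, hF, hMF⟩ := TreeAction.exists_cofinite_isSubtree hfg D.B
  let i := D.incl v D.base_mem
  have hsub := Blowup.isSubtree_preimage_incl hM D.base_mem
  obtain ⟨x₀⟩ := T'.nonempty
  have hch : ∀ f, ∃ (h : G) (y : T'.V), (∃ (h' : G) (y' : T'.V), i y' = h' • f) → i y = h • f := by
    intro f
    by_cases hf : ∃ (h' : G) (y' : T'.V), i y' = h' • f
    · obtain ⟨h, y, hy⟩ := hf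
      exact ⟨h, y, fun _ => hy⟩
    · exact ⟨1, x₀, fun h => absurd h hf⟩
  choose h y hy using hch
  obtain ⟨R, j, hj, hjs, hja, hjr⟩ := hsub.exists_gtree (hF.image y) (by
    intro x hx
    obtain ⟨g, f, hf, hgf⟩ := hMF _ hx
    have hyf : i (y f) = h f • f := hy f ⟨g, x, hgf⟩
    have hxy : i x = (g * (h f)⁻¹) • i (y f) := by
      rw [hyf, mul_smul, inv_smul_smul]
      exact hgf
    have hstab : g * (h f)⁻¹ ∈ T.vertexStab v := by
      have := congrArg D.proj hxy
      rw [D.proj_smul, D.proj_incl, D.proj_incl] at this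
      exact this.symm
    refine ⟨⟨_, hstab⟩, y f, ⟨f, hf, rfl⟩, D.incl_injective v D.base_mem ?_⟩
    rw [D.incl_smul]
    exact hxy)
  refine ⟨R, fun x y hxy => ⟨j x, j y, hja x y hxy, ?_⟩, fun K => ⟨?_, ?_⟩⟩
  · rintro _ ⟨k, ⟨hkx, hky⟩, rfl⟩
    exact ⟨(hjs k x).symm.trans (congrArg j hkx), (hjs k y).symm.trans (congrArg j hky)⟩
  · rintro ⟨x, hx⟩
    refine ⟨j x, ?_⟩
    rintro _ ⟨k, hk, rfl⟩
    exact (hjs k x).symm.trans (congrArg j (hx k hk))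
  · rintro ⟨x, hx⟩
    obtain ⟨_, ⟨z, rfl⟩, hz⟩ := TreeAction.exists_fixed_mem (X := S v) hjr.nonempty hjr.linked K
      (fun k _ m hm => hjr.smul_mem k m hm) (x := x)
      (fun k hk => hx k ⟨k, hk, rfl⟩)
    exact ⟨z, fun k hk => hj ((hjs k z).trans (hz k hk))⟩

/-- Blowing up the vertices of `T` into minimal trees. -/
theorem GTree.exists_blowup (T : GTree G) (S : ∀ w, GTree (T.vertexStab w))
    (hS : ∀ w u, T.graph.Adj w u →
      (S w).EllipticSubgroup ((T.edgeStab w u).subgroupOf (T.vertexStab w))) (v : T.V) :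
    ∃ B : GTree G,
      (∀ a b, B.graph.Adj a b →
        (∃ u w, T.graph.Adj u w ∧ B.edgeStab a b ≤ T.edgeStab u w) ∨
        ∃ (g : G) (w : T.V) (x y : (S w).V), (S w).graph.Adj x y ∧ B.edgeStab a b ≤
          (((S w).edgeStab x y).map (T.vertexStab w).subtype).map (MulAut.conj g).toMonoidHom) ∧
      (∀ K : Subgroup G, B.EllipticSubgroup K →
        ∃ (g : G) (w : T.V) (L : Subgroup (T.vertexStab w)), (S w).EllipticSubgroup L ∧
          K ≤ (L.map (T.vertexStab w).subtype).map (MulAut.conj g).toMonoidHom) ∧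
      ∀ K : Subgroup (T.vertexStab v), B.EllipticSubgroup (K.map (T.vertexStab v).subtype) →
        (S v).EllipticSubgroup K := by
  obtain ⟨D⟩ := Blowup.nonempty (fun w => (S w).toTreeAction) (fun w u hwu => by
    obtain ⟨x, hx⟩ := hS w u hwu
    exact ⟨x, fun h hh => hx h ⟨h.2, hh⟩⟩) v
  have hfix : ∀ {w : T.V} (hw : w ∈ D.R) (g k : G) (x : (S w).V),
      k • g • D.incl w hw x = g • D.incl w hw x →
      ∃ l : T.vertexStab w, (l : G) = g⁻¹ * k * g ∧ l • x = x := by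
    intro w hw g k x hk
    have h1 : (g⁻¹ * k * g) • D.incl w hw x = D.incl w hw x := by
      rw [mul_smul, mul_smul, hk, inv_smul_smul]
    have h2 : g⁻¹ * k * g ∈ T.vertexStab w := by
      have := congrArg D.proj h1
      rwa [D.proj_smul, D.proj_incl] at this
    refine ⟨⟨_, h2⟩, rfl, D.incl_injective w hw ?_⟩
    rw [D.incl_smul]
    exact h1
  have hrep : ∀ b : D.B.V, ∃ (g : G) (w : T.V) (_ : w ∈ D.R), D.proj b = g • w := by
    intro b
    obtain ⟨g, w, hw, hg⟩ := D.exists_rep (D.proj b)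
    exact ⟨g, w, hw, hg⟩
  have hincl : ∀ {b : D.B.V} {g : G} {w : T.V} (hw : w ∈ D.R), D.proj b = g • w →
      ∃ x, b = g • D.incl w hw x := by
    intro b g w hw hb
    obtain ⟨x, hx⟩ := D.exists_incl w hw (g⁻¹ • b) (by rw [D.proj_smul, hb, inv_smul_smul])
    exact ⟨x, by rw [hx, smul_inv_smul]⟩
  refine ⟨D.toGTree fun w M hM => (S w).eq_univ_of_isSubtree hM, ?_, ?_, ?_⟩
  · intro a b hab
    rcases D.proj_adj a b hab with heq | hadj
    · right
      obtain ⟨g, w, hw, hg⟩ := hrep a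
      obtain ⟨x, rfl⟩ := hincl hw hg
      obtain ⟨y, rfl⟩ := hincl hw (heq ▸ hg)
      refine ⟨g, w, x, y, ?_, ?_⟩
      · have := D.B.adj_smul g⁻¹ _ _ hab
        rw [inv_smul_smul, inv_smul_smul] at this
        exact (D.incl_adj w hw x y).1 this
      · rintro k ⟨hka, hkb⟩
        obtain ⟨l, hl, hlx⟩ := hfix hw g k x hka
        obtain ⟨l', hl', hly⟩ := hfix hw g k y hkb
        obtain rfl : l = l' := Subtype.ext (hl.trans hl'.symm)
        refine ⟨l, ⟨l, ⟨hlx, hly⟩, rfl⟩, ?_⟩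
        change g * l * g⁻¹ = k
        rw [hl]
        group
    · left
      refine ⟨_, _, hadj, fun k hk => ⟨?_, ?_⟩⟩
      · exact (D.proj_smul k a).symm.trans (congrArg D.proj hk.1)
      · exact (D.proj_smul k b).symm.trans (congrArg D.proj hk.2)
  · rintro K ⟨b, hb⟩
    obtain ⟨g, w, hw, hg⟩ := hrep b
    obtain ⟨x, rfl⟩ := hincl hw hg
    refine ⟨g, w, (S w).vertexStab x, ⟨x, fun h hh => hh⟩, fun k hk => ?_⟩
    obtain ⟨l, hl, hlx⟩ := hfix hw g k x (hb k hk)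
    refine ⟨l, ⟨l, hlx, rfl⟩, ?_⟩
    change g * l * g⁻¹ = k
    rw [hl]
    group
  · rintro K ⟨b, hb⟩
    obtain ⟨x₀⟩ := (S v).nonempty
    obtain ⟨m, hm, hmk⟩ := TreeAction.exists_fixed_mem (X := D.B) (M := {c | D.proj c = v})
      ⟨_, D.proj_incl v D.base_mem x₀⟩ (fun a ha b hb => D.fibre_linked D.base_mem ha hb)
      (K.map (T.vertexStab v).subtype)
      (by
        rintro _ ⟨k, hk, rfl⟩ m hm
        exact (D.proj_smul _ _).trans ((congrArg ((k : G) • ·) hm).trans k.2))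
      (x := b) hb
    obtain ⟨x, rfl⟩ := D.exists_incl v D.base_mem m hm
    refine ⟨x, fun k hk => D.incl_injective v D.base_mem ?_⟩
    exact (D.incl_smul v D.base_mem k x).trans (hmk k ⟨k, hk, rfl⟩)

/-- The subgroups of a vertex stabilizer belonging to `𝒜`. -/
abbrev GTree.vertexFamily (T : GTree G) (𝒜 : Set (Subgroup G)) (v : T.V) :
    Set (Subgroup (T.vertexStab v)) :=
  {K | K.map (T.vertexStab v).subtype ∈ 𝒜}

/-- The incident edge stabilizers at a vertex. -/
abbrev GTree.incidentFamily (T : GTree G) (v : T.V) : Set (Subgroup (T.vertexStab v)) :=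
  {K | ∃ w : T.V, T.graph.Adj v w ∧ K = (T.edgeStab v w).subgroupOf (T.vertexStab v)}

variable {𝒜 : Set (Subgroup G)} {T : GTree G}

lemma GTree.UnivEllipticSubgroup.mono {H K : Subgroup G} (hH : GTree.UnivEllipticSubgroup 𝒜 H) (hK : K ≤ H) :
    GTree.UnivEllipticSubgroup 𝒜 K :=
  fun X hX => (hH X hX).mono hK

lemma GTree.UnivEllipticSubgroup.conj {H : Subgroup G} (hH : GTree.UnivEllipticSubgroup 𝒜 H) (g : G) :
    GTree.UnivEllipticSubgroup 𝒜 (H.map (MulAut.conj g).toMonoidHom) :=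
  fun X hX => (hH X hX).conj g

/-- A vertex stabilizer of a universally elliptic tree has a minimal relative tree in each
`𝒜`-tree. -/
lemma exists_relATree (hfg : Group.FG G) (h𝒜 : ClosedFamily 𝒜) (hTue : T.UnivEllipticTree 𝒜)
    (X : GTree G) (hX : X.IsATree 𝒜) (v : T.V) :
    ∃ R : GTree (T.vertexStab v), RelATree (T.vertexFamily 𝒜 v) (T.incidentFamily v) R ∧
      (∀ x y, R.graph.Adj x y → ∃ a b, X.graph.Adj a b ∧
        (R.edgeStab x y).map (T.vertexStab v).subtype ≤ X.edgeStab a b) ∧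
      ∀ K : Subgroup (T.vertexStab v), R.EllipticSubgroup K ↔
        X.EllipticSubgroup (K.map (T.vertexStab v).subtype) := by
  obtain ⟨R, hR, hRell⟩ := GTree.exists_restriction hfg T X (fun a b h => hTue a b h X hX) v
  refine ⟨R, ⟨fun x y hxy => ?_, ?_⟩, hR, hRell⟩
  · obtain ⟨a, b, hab, hle⟩ := hR x y hxy
    exact h𝒜.2 _ (hX a b hab) _ hle
  · rintro _ ⟨w, hw, rfl⟩
    exact (hRell _).2 ((hTue v w hw X hX).mono (by rintro _ ⟨k, hk, rfl⟩; exact hk))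

/-- Relative universal ellipticity in a vertex stabilizer implies universal ellipticity. -/
lemma univElliptic_of_rel (hfg : Group.FG G) (h𝒜 : ClosedFamily 𝒜) (hTue : T.UnivEllipticTree 𝒜)
    {v : T.V} {K : Subgroup (T.vertexStab v)}
    (hK : RelUnivEllipticSubgroup (T.vertexFamily 𝒜 v) (T.incidentFamily v) K) :
    GTree.UnivEllipticSubgroup 𝒜 (K.map (T.vertexStab v).subtype) := by
  intro X hX
  obtain ⟨R, hR, -, hRell⟩ := exists_relATree hfg h𝒜 hTue X hX v
  exact (hRell K).1 (hK R hR)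

/-- A blow-up of a universally elliptic tree at relative trees is an `𝒜`-tree, universally
elliptic if the relative trees are. -/
lemma exists_blowup_family (hfg : Group.FG G) (h𝒜 : ClosedFamily 𝒜) (hT : T.IsATree 𝒜)
    (hTue : T.UnivEllipticTree 𝒜) (S : ∀ w, GTree (T.vertexStab w))
    (hS : ∀ w, RelATree (T.vertexFamily 𝒜 w) (T.incidentFamily w) (S w)) (v : T.V) :
    ∃ B : GTree G, B.IsATree 𝒜 ∧
      ((∀ w, RelUnivEllipticTree (T.vertexFamily 𝒜 w) (T.incidentFamily w) (S w)) →
        B.UnivEllipticTree 𝒜) ∧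
      (∀ K : Subgroup G, B.EllipticSubgroup K →
        ∃ (g : G) (w : T.V) (L : Subgroup (T.vertexStab w)), (S w).EllipticSubgroup L ∧
          K ≤ (L.map (T.vertexStab w).subtype).map (MulAut.conj g).toMonoidHom) ∧
      ∀ K : Subgroup (T.vertexStab v), B.EllipticSubgroup (K.map (T.vertexStab v).subtype) →
        (S v).EllipticSubgroup K := by
  obtain ⟨B, hB, hell, hv⟩ := T.exists_blowup S (fun w u h => (hS w).2 _ ⟨u, h, rfl⟩) v
  refine ⟨B, fun a b hab => ?_, fun hSue a b hab => ?_, hell, hv⟩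
  · rcases hB a b hab with ⟨u, w, huw, hle⟩ | ⟨g, w, x, y, hxy, hle⟩
    · exact h𝒜.2 _ (hT u w huw) _ hle
    · exact h𝒜.2 _ (h𝒜.1 _ ((hS w).1 x y hxy) g) _ hle
  · rcases hB a b hab with ⟨u, w, huw, hle⟩ | ⟨g, w, x, y, hxy, hle⟩
    · exact GTree.UnivEllipticSubgroup.mono (hTue u w huw) hle
    · exact GTree.UnivEllipticSubgroup.mono
        (GTree.UnivEllipticSubgroup.conj (univElliptic_of_rel hfg h𝒜 hTue (hSue w x y hxy)) g) hle

/-- The tree with one vertex. -/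
abbrev GTree.point (H : Type u) [Group H] : GTree H where
  V := PUnit
  graph := ⊥
  nonempty := inferInstance
  connected := SimpleGraph.IsTree.of_subsingleton.connected
  acyclic := SimpleGraph.IsAcyclic.of_subsingleton
  act := fun _ x => x
  act_one := fun _ => rfl
  act_mul := fun _ _ _ => rfl
  act_adj := fun _ _ _ h => h
  noInversion := fun _ _ _ h => h.elim
  minimal := fun _ hne _ _ => Set.eq_univ_of_forall fun x =>
    (Subsingleton.elim hne.some x) ▸ hne.some_mem

/-- Blowing up a universally elliptic tree at a single orbit of vertices. -/
lemma exists_blowup_single (hfg : Group.FG G) (h𝒜 : ClosedFamily 𝒜) (hT : T.IsATree 𝒜)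
    (hTue : T.UnivEllipticTree 𝒜) (v : T.V) (R : GTree (T.vertexStab v))
    (hR : RelATree (T.vertexFamily 𝒜 v) (T.incidentFamily v) R) :
    ∃ B : GTree G, B.IsATree 𝒜 ∧
      (RelUnivEllipticTree (T.vertexFamily 𝒜 v) (T.incidentFamily v) R →
        B.UnivEllipticTree 𝒜) ∧
      ∀ K : Subgroup (T.vertexStab v), B.EllipticSubgroup (K.map (T.vertexStab v).subtype) →
        R.EllipticSubgroup K := by
  classical
  let S : ∀ w, GTree (T.vertexStab w) :=
    Function.update (fun w => GTree.point (T.vertexStab w)) v R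
  have hSv : S v = R := Function.update_self ..
  have hSne : ∀ w, w ≠ v → S w = GTree.point _ := fun w hw => Function.update_of_ne hw ..
  obtain ⟨B, hB, hBue, -, hv⟩ := exists_blowup_family hfg h𝒜 hT hTue S (fun w => by
    by_cases hw : w = v
    · subst hw
      rwa [hSv]
    · rw [hSne w hw]
      exact ⟨fun _ _ h => h.elim, fun _ _ => ⟨PUnit.unit, fun _ _ => rfl⟩⟩) v
  refine ⟨B, hB, fun hRue => hBue fun w => ?_, fun K hK => hSv ▸ hv K hK⟩
  by_cases hw : w = v
  · subst hw
    rwa [hSv]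
  · rw [hSne w hw]
    exact fun _ _ h => h.elim

/-- Universal ellipticity in `G` implies relative universal ellipticity in vertex stabilizers. -/
lemma relUnivElliptic_of_le (hfg : Group.FG G) (h𝒜 : ClosedFamily 𝒜) (hT : T.IsATree 𝒜)
    (hTue : T.UnivEllipticTree 𝒜) {H : Subgroup G} (hH : GTree.UnivEllipticSubgroup 𝒜 H)
    {v : T.V} {K : Subgroup (T.vertexStab v)} (hK : K.map (T.vertexStab v).subtype ≤ H) :
    RelUnivEllipticSubgroup (T.vertexFamily 𝒜 v) (T.incidentFamily v) K := by
  intro R hR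
  obtain ⟨B, hB, -, hell⟩ := exists_blowup_single hfg h𝒜 hT hTue v R hR
  exact hell K ((hH B hB).mono hK)

/-- The minimal subtree of a vertex stabilizer in a universally elliptic tree is universally
elliptic relative to the incident edge stabilizers. -/
lemma exists_relUnivEllipticTree (hfg : Group.FG G) (h𝒜 : ClosedFamily 𝒜) (hT : T.IsATree 𝒜)
    (hTue : T.UnivEllipticTree 𝒜) (X : GTree G) (hX : X.IsATree 𝒜)
    (hXue : X.UnivEllipticTree 𝒜) (v : T.V) :
    ∃ R : GTree (T.vertexStab v), RelATree (T.vertexFamily 𝒜 v) (T.incidentFamily v) R ∧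
      RelUnivEllipticTree (T.vertexFamily 𝒜 v) (T.incidentFamily v) R ∧
      ∀ K : Subgroup (T.vertexStab v), R.EllipticSubgroup K ↔
        X.EllipticSubgroup (K.map (T.vertexStab v).subtype) := by
  obtain ⟨R, hR, hedge, hell⟩ := exists_relATree hfg h𝒜 hTue X hX v
  refine ⟨R, hR, fun x y hxy => ?_, hell⟩
  obtain ⟨a, b, hab, hle⟩ := hedge x y hxy
  exact relUnivElliptic_of_le hfg h𝒜 hT hTue (hXue a b hab) hle

end Vertex

/-- `G` has a JSJ tree over `𝒜` iff each vertex stabilizer of a universally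
elliptic `𝒜`-tree has a JSJ tree relative to its incident edge stabilizers. -/
theorem jsj_iff_vertex_relative_jsj {G : Type u} [Group G] (hfg : Group.FG G)
    (𝒜 : Set (Subgroup G)) (h𝒜 : ClosedFamily 𝒜)
    (T : GTree G) (hT : T.IsATree 𝒜) (hTue : T.UnivEllipticTree 𝒜) :
    (∃ S : GTree G, S.IsJSJ 𝒜) ↔
      ∀ v : T.V, ∃ S : GTree ↥(T.vertexStab v),
        IsRelJSJ
          {K : Subgroup ↥(T.vertexStab v) | Subgroup.map (T.vertexStab v).subtype K ∈ 𝒜}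
          {K : Subgroup ↥(T.vertexStab v) |
            ∃ w : T.V, T.graph.Adj v w ∧ K = (T.edgeStab v w).subgroupOf (T.vertexStab v)}
          S := by
  constructor
  · rintro ⟨X, hX, hXue, hXdom⟩ v
    obtain ⟨R, hR, hRue, hell⟩ := exists_relUnivEllipticTree hfg h𝒜 hT hTue X hX hXue v
    refine ⟨R, hR, hRue, fun R' hR' hRue' K hK => ?_⟩
    obtain ⟨B, hB, hBue, hBell⟩ := exists_blowup_single hfg h𝒜 hT hTue v R' hR'
    exact hBell K (hXdom B hB (hBue hRue') _ ((hell K).1 hK))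
  · intro h
    choose S hS hSue hSdom using h
    obtain ⟨v⟩ := T.nonempty
    obtain ⟨B, hB, hBue, hell, -⟩ := exists_blowup_family hfg h𝒜 hT hTue S hS v
    refine ⟨B, hB, hBue hSue, fun X hX hXue K hK => ?_⟩
    obtain ⟨g, w, L, hL, hKL⟩ := hell K hK
    obtain ⟨R, hR, hRue, hRell⟩ := exists_relUnivEllipticTree hfg h𝒜 hT hTue X hX hXue w
    exact (((hRell L).1 (hSdom w R hR hRue L hL)).conj g).mono hKL
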